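/- arXiv:1402.2918 — 3 statements merged into one kernel-verified Lean document; each statement's English description precedes it below -/
import Mathlib

section
/- Let 𝒯 ⊆ (0,1) with inf 𝒯 = 0 and sup 𝒯 = 1, and let X = (X(t))_{t∈𝒯} be a stochastic process satisfying Condition (C) with constant M ≥ 1 and function L, with all suprema of X over sets of the form [ℓ(a), ℓ(a+c)] ∩ 𝒯 measurable. Then for any ν > 1, almost surely X(t) − C(t) − ν·D(t) → −∞ as t → 0 along 𝒯 and as t → 1 along 𝒯. -/
open MeasureTheory Filter Set

/-- The logistic function ℓ(x) = eˣ/(1+eˣ). -/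
noncomputable def logistic (x : ℝ) : ℝ := Real.exp x / (1 + Real.exp x)

/-- C(t) = log log ( e / (4 t (1−t)) ). -/
noncomputable def Cfun (t : ℝ) : ℝ := Real.log (Real.log (Real.exp 1 / (4 * t * (1 - t))))

/-- D(t) = log (1 + C(t)²). -/
noncomputable def Dfun (t : ℝ) : ℝ := Real.log (1 + Cfun t ^ 2)

lemma logistic_eq_sigmoid (x : ℝ) : logistic x = Real.sigmoid x := by
  have h := Real.exp_pos x
  rw [logistic, Real.sigmoid_def, Real.exp_neg]
  field_simp
  ring

lemma strictMono_logistic : StrictMono logistic := by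
  rw [funext logistic_eq_sigmoid]
  exact Real.sigmoid_strictMono

lemma logistic_lt_one (x : ℝ) : logistic x < 1 := by
  rw [logistic_eq_sigmoid]
  exact Real.sigmoid_lt_one x

lemma logistic_neg (x : ℝ) : logistic (-x) = 1 - logistic x := by
  simp only [logistic_eq_sigmoid, Real.sigmoid_neg]

lemma exists_logistic_eq {t : ℝ} (ht : t ∈ Ioo (0 : ℝ) 1) : ∃ x, logistic x = t := by
  rw [← Real.range_sigmoid] at ht
  obtain ⟨x, hx⟩ := ht
  exact ⟨x, by rw [logistic_eq_sigmoid, hx]⟩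

lemma Cfun_one_sub (t : ℝ) : Cfun (1 - t) = Cfun t := by
  rw [Cfun, Cfun, show 4 * (1 - t) * (1 - (1 - t)) = 4 * t * (1 - t) by ring]

lemma Dfun_one_sub (t : ℝ) : Dfun (1 - t) = Dfun t := by
  rw [Dfun, Dfun, Cfun_one_sub]

lemma sub_one_le_log_logistic (x : ℝ) :
    x - 1 ≤ Real.log (Real.exp 1 / (4 * logistic x * (1 - logistic x))) := by
  have h := Real.exp_pos x
  have key : Real.exp 1 / (4 * logistic x * (1 - logistic x))
      = Real.exp 1 * (1 + Real.exp x) ^ 2 / (4 * Real.exp x) := by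
    rw [logistic]
    field_simp
    ring
  rw [key, Real.le_log_iff_exp_le (by positivity), Real.exp_sub,
    div_le_div_iff₀ (by positivity) (by positivity)]
  have h2 := Real.exp_one_gt_two
  nlinarith [mul_le_mul h2.le h2.le (by norm_num) (by positivity), sq_nonneg (Real.exp x)]

lemma le_Cfun_logistic {u x : ℝ} (hu : 0 ≤ u) (hx : Real.exp (u + 1) ≤ x) :
    u ≤ Cfun (logistic x) := by
  have hu1 : 1 ≤ Real.exp u := Real.one_le_exp hu
  have h2 := Real.exp_one_gt_two
  have hxu : Real.exp u ≤ x - 1 := by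
    rw [Real.exp_add] at hx
    nlinarith
  have h := hxu.trans (sub_one_le_log_logistic x)
  rw [Cfun]
  exact (Real.le_log_iff_exp_le ((Real.exp_pos u).trans_le h)).2 h

lemma log_one_add_sq_le {j : ℝ} (hj : 0 ≤ j) : Real.log (1 + j ^ 2) ≤ 2 * (j + 1) := by
  have h : Real.log (1 + j ^ 2) ≤ Real.log ((j + 1) ^ 2) :=
    Real.log_le_log (by positivity) (by nlinarith)
  have h' := Real.log_le_sub_one_of_pos (show (0 : ℝ) < j + 1 by linarith)
  rw [Real.log_pow] at h
  push_cast at h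
  linarith

lemma two_mul_log_le {j : ℝ} (hj : 0 ≤ j) :
    2 * Real.log (j + 1) ≤ Real.log 2 + Real.log (1 + j ^ 2) := by
  have h : Real.log ((j + 1) ^ 2) ≤ Real.log (2 * (1 + j ^ 2)) :=
    Real.log_le_log (by positivity) (by nlinarith [sq_nonneg (j - 1)])
  rw [Real.log_pow, Real.log_mul (by norm_num) (by positivity)] at h
  exact_mod_cast h

lemma block_bound {M K μ j : ℝ} (hM : 0 ≤ M) (hK : 0 ≤ K) (hμ : 0 ≤ μ) (hj : 0 ≤ j) :
    ((⌊Real.exp (j + 2) * (j + 1)⌋₊ + 1 : ℕ) : ℝ) *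
        (M * Real.exp (-((1 - K * (1 / (j + 1))) * (j + μ * Real.log (1 + j ^ 2)))))
      ≤ M * Real.exp (Real.log 2 + 2 + μ * Real.log 2 + K * (1 + 2 * μ)) *
        (j + 1) ^ (1 - 2 * μ) := by
  have hu : 0 < j + 1 := by linarith
  have hN : ((⌊Real.exp (j + 2) * (j + 1)⌋₊ + 1 : ℕ) : ℝ)
      ≤ Real.exp (Real.log 2 + (j + 2) + Real.log (j + 1)) := by
    rw [Real.exp_add _ (Real.log (j + 1)), Real.exp_add (Real.log 2), Real.exp_log hu,
      Real.exp_log two_pos]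
    have h1 := Nat.floor_le (show 0 ≤ Real.exp (j + 2) * (j + 1) by positivity)
    have h2 : 1 ≤ Real.exp (j + 2) := Real.one_le_exp (by linarith)
    push_cast
    nlinarith
  have hη : (j + μ * Real.log (1 + j ^ 2)) / (j + 1) ≤ 1 + 2 * μ := by
    rw [div_le_iff₀ hu]
    nlinarith [mul_le_mul_of_nonneg_left (log_one_add_sq_le hj) hμ]
  have hexp : -((1 - K * (1 / (j + 1))) * (j + μ * Real.log (1 + j ^ 2)))
      ≤ -j - μ * (2 * Real.log (j + 1) - Real.log 2) + K * (1 + 2 * μ) := by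
    have h1 := mul_le_mul_of_nonneg_left hη hK
    have h2 := mul_le_mul_of_nonneg_left (two_mul_log_le hj) hμ
    have h3 : -((1 - K * (1 / (j + 1))) * (j + μ * Real.log (1 + j ^ 2)))
        = -(j + μ * Real.log (1 + j ^ 2))
          + K * ((j + μ * Real.log (1 + j ^ 2)) / (j + 1)) := by ring
    rw [h3]
    linarith
  calc _ ≤ Real.exp (Real.log 2 + (j + 2) + Real.log (j + 1)) *
        (M * Real.exp (-j - μ * (2 * Real.log (j + 1) - Real.log 2) + K * (1 + 2 * μ))) := by
        gcongr
    _ = _ := by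
        rw [Real.rpow_def_of_pos hu, mul_left_comm, mul_assoc, ← Real.exp_add, ← Real.exp_add]
        congr 2
        ring

lemma exists_subinterval {α δ x B : ℝ} (hδ : 0 < δ) (hx : α ≤ x) (hB : x - α ≤ B) :
    ∃ i ∈ Finset.range (⌊B / δ⌋₊ + 1), α + i * δ ≤ x ∧ x ≤ α + i * δ + δ := by
  have h0 : 0 ≤ (x - α) / δ := div_nonneg (by linarith) hδ.le
  refine ⟨⌊(x - α) / δ⌋₊, ?_, ?_, ?_⟩
  · rw [Finset.mem_range, Nat.lt_succ_iff]
    gcongr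
  · have h := Nat.floor_le h0
    rw [le_div_iff₀ hδ] at h
    linarith
  · have h := Nat.lt_floor_add_one ((x - α) / δ)
    rw [div_lt_iff₀ hδ] at h
    linarith

section OneSided

variable {Ω : Type*} [MeasurableSpace Ω] (P : Measure Ω) (T : Set ℝ) (X : ℝ → Ω → ℝ)

/-- Exceedance event on the block `[ℓ(e^(j+1)), ℓ(e^(j+2))]` of the level `j + μ log (1 + j²)`. -/
def blockEvent (μ : ℝ) (j : ℕ) : Set Ω :=
  {ω | ∃ t ∈ Icc (logistic (Real.exp (j + 1))) (logistic (Real.exp (j + 2))) ∩ T,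
    (j : ℝ) + μ * Real.log (1 + (j : ℝ) ^ 2) < X t ω}

lemma measure_blockEvent_le (hT : T ⊆ Ioo 0 1) {M K μ : ℝ} (hM : 0 ≤ M) (hK : 0 ≤ K)
    (hC : ∀ a c : ℝ, 0 ≤ c → ∀ η : ℝ, 0 ≤ η →
      P {ω | ∃ t ∈ Icc (logistic a) (logistic (a + c)) ∩ T, η < X t ω}
        ≤ ENNReal.ofReal (M * Real.exp (-((1 - K * c) * η))))
    (hμ : 0 ≤ μ) (j : ℕ) :
    P (blockEvent T X μ j) ≤ ENNReal.ofReal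
      (M * Real.exp (Real.log 2 + 2 + μ * Real.log 2 + K * (1 + 2 * μ)) *
        ((j : ℝ) + 1) ^ (1 - 2 * μ)) := by
  have hj : (0 : ℝ) ≤ j := j.cast_nonneg
  have hδ : 0 < 1 / ((j : ℝ) + 1) := by positivity
  set η : ℝ := (j : ℝ) + μ * Real.log (1 + (j : ℝ) ^ 2) with hη_def
  have hη : 0 ≤ η := by
    have : 0 ≤ Real.log (1 + (j : ℝ) ^ 2) := Real.log_nonneg (by nlinarith)
    positivity
  set N := ⌊Real.exp ((j : ℝ) + 2) * ((j : ℝ) + 1)⌋₊ + 1 with hN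
  have hsub : blockEvent T X μ j ⊆ ⋃ i ∈ Finset.range N,
      {ω | ∃ t ∈ Icc (logistic (Real.exp (j + 1) + i * (1 / ((j : ℝ) + 1))))
        (logistic (Real.exp (j + 1) + i * (1 / ((j : ℝ) + 1)) + 1 / ((j : ℝ) + 1))) ∩ T,
        η < X t ω} := by
    rintro ω ⟨t, ⟨⟨h1, h2⟩, htT⟩, ht⟩
    obtain ⟨x, rfl⟩ := exists_logistic_eq (hT htT)
    rw [strictMono_logistic.le_iff_le] at h1 h2
    obtain ⟨i, hi, hi1, hi2⟩ := exists_subinterval hδ h1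
      (show x - Real.exp (j + 1) ≤ Real.exp (j + 2) by linarith [Real.exp_pos ((j : ℝ) + 1)])
    rw [div_div_eq_mul_div, div_one] at hi
    simp only [mem_iUnion]
    exact ⟨i, hi, _, ⟨⟨strictMono_logistic.monotone hi1, strictMono_logistic.monotone hi2⟩, htT⟩,
      ht⟩
  calc P (blockEvent T X μ j)
      ≤ ∑ _i ∈ Finset.range N,
          ENNReal.ofReal (M * Real.exp (-((1 - K * (1 / ((j : ℝ) + 1))) * η))) :=
        (measure_mono hsub).trans <| (measure_biUnion_finset_le _ _).trans <|
          Finset.sum_le_sum fun i _ => hC _ _ hδ.le _ hη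
    _ = ENNReal.ofReal (N * (M * Real.exp (-((1 - K * (1 / ((j : ℝ) + 1))) * η)))) := by
        rw [Finset.sum_const, Finset.card_range, nsmul_eq_mul,
          ENNReal.ofReal_mul N.cast_nonneg, ENNReal.ofReal_natCast]
    _ ≤ _ := ENNReal.ofReal_le_ofReal (block_bound hM hK hμ hj)

lemma ae_eventually_notMem_blockEvent (hT : T ⊆ Ioo 0 1) {M K μ : ℝ} (hM : 0 ≤ M) (hK : 0 ≤ K)
    (hC : ∀ a c : ℝ, 0 ≤ c → ∀ η : ℝ, 0 ≤ η →
      P {ω | ∃ t ∈ Icc (logistic a) (logistic (a + c)) ∩ T, η < X t ω}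
        ≤ ENNReal.ofReal (M * Real.exp (-((1 - K * c) * η))))
    (hμ : 1 < μ) :
    ∀ᵐ ω ∂P, ∀ᶠ j in atTop, ω ∉ blockEvent T X μ j := by
  refine ae_eventually_notMem (ne_top_of_le_ne_top ?_ (ENNReal.tsum_le_tsum
    (measure_blockEvent_le P T X hT hM hK hC (by linarith))))
  refine Summable.tsum_ofReal_ne_top (Summable.mul_left _ ?_)
  have h := (Real.summable_nat_rpow (p := 1 - 2 * μ)).2 (by linarith)
  exact_mod_cast (summable_nat_add_iff 1).2 h

lemma ae_tendsto_nhdsWithin_one (hT : T ⊆ Ioo 0 1) {M K ν : ℝ} (hM : 0 ≤ M) (hK : 0 ≤ K)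
    (hC : ∀ a c : ℝ, 0 ≤ c → ∀ η : ℝ, 0 ≤ η →
      P {ω | ∃ t ∈ Icc (logistic a) (logistic (a + c)) ∩ T, η < X t ω}
        ≤ ENNReal.ofReal (M * Real.exp (-((1 - K * c) * η))))
    (hν : 1 < ν) :
    ∀ᵐ ω ∂P, Tendsto (fun t => X t ω - Cfun t - ν * Dfun t) (nhdsWithin 1 T) atBot := by
  obtain ⟨μ, hμ, hμν⟩ := exists_between hν
  filter_upwards [ae_eventually_notMem_blockEvent P T X hT hM hK hC hμ] with ω hω
  rw [tendsto_atBot]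
  intro b
  have hlog : Tendsto (fun j : ℕ => (ν - μ) * Real.log (1 + (j : ℝ) ^ 2)) atTop atTop :=
    (Real.tendsto_log_atTop.comp (tendsto_atTop_add_const_left _ 1
      ((tendsto_pow_atTop two_ne_zero).comp tendsto_natCast_atTop_atTop))).const_mul_atTop
      (sub_pos.2 hμν)
  obtain ⟨J, hJ⟩ := eventually_atTop.1 (hω.and (hlog.eventually_ge_atTop (-b)))
  filter_upwards [self_mem_nhdsWithin, nhdsWithin_le_nhds
    (Ioi_mem_nhds (logistic_lt_one (Real.exp (J + 1))))] with t htT ht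
  obtain ⟨x, rfl⟩ := exists_logistic_eq (hT htT)
  have hx : Real.exp (J + 1) < x := strictMono_logistic.lt_iff_lt.1 ht
  have hx0 : 0 < x := (Real.exp_pos _).trans hx
  have hlx : (J : ℝ) + 1 < Real.log x := (Real.lt_log_iff_exp_lt hx0).2 hx
  have hJ0 : (0 : ℝ) ≤ J := J.cast_nonneg
  set j := ⌊Real.log x - 1⌋₊ with hj
  have hJj : J ≤ j := Nat.le_floor (by linarith)
  have hj1 : (j : ℝ) ≤ Real.log x - 1 := Nat.floor_le (by linarith)
  have hj2 : Real.log x - 1 < j + 1 := Nat.lt_floor_add_one _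
  have hlow : Real.exp (j + 1) ≤ x := (Real.le_log_iff_exp_le hx0).1 (by linarith)
  have hupp : x ≤ Real.exp (j + 2) := (Real.log_le_iff_le_exp hx0).1 (by linarith)
  obtain ⟨hE, hb⟩ := hJ j hJj
  have hX : X (logistic x) ω ≤ j + μ * Real.log (1 + (j : ℝ) ^ 2) := by
    by_contra! h
    exact hE ⟨_, ⟨⟨strictMono_logistic.monotone hlow, strictMono_logistic.monotone hupp⟩, htT⟩, h⟩
  have hjC : (j : ℝ) ≤ Cfun (logistic x) := le_Cfun_logistic j.cast_nonneg hlow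
  have hD : Real.log (1 + (j : ℝ) ^ 2) ≤ Dfun (logistic x) :=
    Real.log_le_log (by positivity) (by gcongr)
  have := mul_le_mul_of_nonneg_left hD (by linarith : 0 ≤ ν)
  linarith

end OneSided

/-- Remark 2.2 of Dümbgen–Wellner: if `X` on `T ⊆ (0,1)` with `inf T = 0`, `sup T = 1`
satisfies Condition (C), then for any `ν > 1`, almost surely
`X(t) − C(t) − ν D(t) → −∞` as `t → 0` along `T` and as `t → 1` along `T`. -/
theorem stmt1
    {Ω : Type*} [MeasurableSpace Ω] (P : Measure Ω) [IsProbabilityMeasure P]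
    (T : Set ℝ) (hT : T ⊆ Set.Ioo 0 1) (hTinf : sInf T = 0) (hTsup : sSup T = 1)
    (X : ℝ → Ω → ℝ)
    (M : ℝ) (hM : 1 ≤ M)
    (L : ℝ → ℝ)
    (hLanti : ∀ c₁ c₂ : ℝ, 0 ≤ c₁ → c₁ ≤ c₂ → L c₂ ≤ L c₁)
    (hLrange : ∀ c : ℝ, 0 ≤ c → L c ∈ Set.Icc (0:ℝ) 1)
    (hLnear : ∃ K₀ > (0:ℝ), ∃ c₀ > (0:ℝ), ∀ c : ℝ, 0 ≤ c → c ≤ c₀ → 1 - K₀ * c ≤ L c)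
    (hmeas : ∀ a c η : ℝ, MeasurableSet
      {ω | ∃ t ∈ Set.Icc (logistic a) (logistic (a + c)) ∩ T, η < X t ω})
    (hC : ∀ a c : ℝ, 0 ≤ c → ∀ η : ℝ,
      P {ω | ∃ t ∈ Set.Icc (logistic a) (logistic (a + c)) ∩ T, η < X t ω}
        ≤ ENNReal.ofReal (M * Real.exp (-(L c * η))))
    (ν : ℝ) (hν : 1 < ν) :
    ∀ᵐ ω ∂P,
      Filter.Tendsto (fun t => X t ω - Cfun t - ν * Dfun t) (nhdsWithin 0 T) Filter.atBot ∧
      Filter.Tendsto (fun t => X t ω - Cfun t - ν * Dfun t) (nhdsWithin 1 T) Filter.atBot := by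
  obtain ⟨K₀, hK₀, c₀, hc₀, hL⟩ := hLnear
  have hM0 : 0 ≤ M := by linarith
  set K := max K₀ (1 / c₀) with hK_def
  have hK : 0 ≤ K := hK₀.le.trans (le_max_left _ _)
  have hKL : ∀ c, 0 ≤ c → 1 - K * c ≤ L c := by
    intro c hc
    rcases le_or_gt c c₀ with h | h
    · have := mul_le_mul_of_nonneg_right (le_max_left K₀ (1 / c₀)) hc
      linarith [hL c hc h]
    · have h1 := mul_le_mul_of_nonneg_right (le_max_right K₀ (1 / c₀)) hc
      have h2 : 1 ≤ 1 / c₀ * c := by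
        rw [one_div_mul_eq_div, one_le_div hc₀]
        exact h.le
      linarith [(hLrange c hc).1]
  have hC' : ∀ a c : ℝ, 0 ≤ c → ∀ η : ℝ, 0 ≤ η →
      P {ω | ∃ t ∈ Icc (logistic a) (logistic (a + c)) ∩ T, η < X t ω}
        ≤ ENNReal.ofReal (M * Real.exp (-((1 - K * c) * η))) := by
    intro a c hc η hη
    refine (hC a c hc η).trans (ENNReal.ofReal_le_ofReal ?_)
    have := hKL c hc
    gcongr
  let T' : Set ℝ := (fun t => 1 - t) ⁻¹' T
  have hT' : T' ⊆ Ioo 0 1 := fun t ht => by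
    have := hT ht
    exact ⟨by linarith [this.2], by linarith [this.1]⟩
  have hCrefl : ∀ a c : ℝ, 0 ≤ c → ∀ η : ℝ, 0 ≤ η →
      P {ω | ∃ t ∈ Icc (logistic a) (logistic (a + c)) ∩ T', η < X (1 - t) ω}
        ≤ ENNReal.ofReal (M * Real.exp (-((1 - K * c) * η))) := by
    intro a c hc η hη
    refine (measure_mono ?_).trans (hC' (-(a + c)) c hc η hη)
    rintro ω ⟨t, ⟨⟨h1, h2⟩, htT⟩, ht⟩
    refine ⟨1 - t, ⟨⟨?_, ?_⟩, htT⟩, ht⟩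
    · rw [logistic_neg]
      linarith
    · rw [show -(a + c) + c = -a by ring, logistic_neg]
      linarith
  filter_upwards [ae_tendsto_nhdsWithin_one P T X hT hM0 hK hC' hν,
    ae_tendsto_nhdsWithin_one P T' (fun t => X (1 - t)) hT' hM0 hK hCrefl hν] with ω h1 h0
  refine ⟨?_, h1⟩
  have hrefl : Tendsto (fun t : ℝ => 1 - t) (nhdsWithin 0 T) (nhdsWithin 1 T') := by
    refine tendsto_nhdsWithin_iff.2 ⟨?_, ?_⟩
    · have : Tendsto (fun t : ℝ => 1 - t) (nhds 0) (nhds (1 - 0)) :=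
        (continuous_const.sub continuous_id).tendsto 0
      rw [sub_zero] at this
      exact this.mono_left nhdsWithin_le_nhds
    · filter_upwards [self_mem_nhdsWithin] with t ht
      simpa [T'] using ht
  refine (h0.comp hrefl).congr fun t => ?_
  simp only [Function.comp_apply, sub_sub_cancel, Cfun_one_sub, Dfun_one_sub]
end

section
/- Let (ε_n) be a sequence in (0,1) with log(ε_n)/log(n) → −1/2 and such that π_n := √n·ε_n → 0. Fix s > 1, set μ_n := √(2·s·log(1/π_n)), and let F_n(x) := (1−ε_n)·Φ(x) + ε_n·Φ(x−μ_n). Then Δ_n(F_n, Φ) → ∞ as n → ∞. -/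
open MeasureTheory Filter Set ProbabilityTheory

/-- Γ(t) = C(t) + 1. -/
noncomputable def Gammafun (t : ℝ) : ℝ := Cfun t + 1

/-- The standard normal distribution function Φ. -/
noncomputable def Phi (x : ℝ) : ℝ := (ProbabilityTheory.gaussianReal 0 1 (Set.Iic x)).toReal

/-- Δ_n(F, F_o) = sup over x with F_o(x) ∈ (0,1) of
`√n |F(x) − F_o(x)| / ( √(Γ(F_o(x)) F_o(x)(1−F_o(x))) + Γ(F_o(x))/√n )`. -/
noncomputable def Deltafun (n : ℕ) (F Fo : ℝ → ℝ) : ℝ :=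
  sSup ((fun x => Real.sqrt n * |F x - Fo x| /
      (Real.sqrt (Gammafun (Fo x) * (Fo x * (1 - Fo x))) + Gammafun (Fo x) / Real.sqrt n))
    '' {x : ℝ | Fo x ∈ Set.Ioo (0:ℝ) 1})

lemma Phi_sub_Phi {a b : ℝ} (hab : a ≤ b) :
    Phi b - Phi a = (gaussianReal 0 1).real (Ioc a b) := by
  have h : Iic b \ Iic a = Ioc a b := by ext x; simp [and_comm]
  rw [← h, measureReal_sdiff (Iic_subset_Iic.2 hab) measurableSet_Iic]
  rfl

lemma Phi_nonneg (x : ℝ) : 0 ≤ Phi x := ENNReal.toReal_nonneg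

lemma Phi_le_one (x : ℝ) : Phi x ≤ 1 := measureReal_le_one (μ := gaussianReal 0 1)

lemma one_sub_Phi (x : ℝ) : 1 - Phi x = (gaussianReal 0 1).real (Ioi x) := by
  rw [← compl_Iic, probReal_compl_eq_one_sub measurableSet_Iic]
  rfl

/-- The mass of `(a, a + 1]` is at least the density at the right end point. -/
lemma density_le_gaussianReal_Ioc {a : ℝ} (ha : 0 ≤ a) :
    (√(2 * Real.pi))⁻¹ * Real.exp (-(a + 1) ^ 2 / 2) ≤
      (gaussianReal 0 1).real (Ioc a (a + 1)) := by
  have h := setIntegral_ge_of_const_le_real (μ := volume) (s := Ioc a (a + 1))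
    (f := gaussianPDFReal 0 1) (c := (√(2 * Real.pi))⁻¹ * Real.exp (-(a + 1) ^ 2 / 2))
    measurableSet_Ioc (by simp) ?_ (integrable_gaussianPDFReal 0 1).integrableOn
  · rw [measureReal_def, gaussianReal_apply_eq_integral 0 one_ne_zero, ENNReal.toReal_ofReal
      (setIntegral_nonneg measurableSet_Ioc fun x _ => gaussianPDFReal_nonneg 0 1 x)]
    simpa using h
  · intro x hx
    simp only [gaussianPDFReal, NNReal.coe_one, mul_one, sub_zero]
    have : x ^ 2 ≤ (a + 1) ^ 2 := pow_le_pow_left₀ (ha.trans hx.1.le) hx.2 2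
    gcongr

lemma density_le_one_sub_Phi {a : ℝ} (ha : 0 ≤ a) :
    (√(2 * Real.pi))⁻¹ * Real.exp (-(a + 1) ^ 2 / 2) ≤ 1 - Phi a := by
  rw [one_sub_Phi]
  exact (density_le_gaussianReal_Ioc ha).trans (measureReal_mono Ioc_subset_Ioi_self)

lemma one_sub_Phi_le {a : ℝ} (ha : 0 ≤ a) : 1 - Phi a ≤ Real.exp (-a ^ 2 / 2) := by
  rw [one_sub_Phi]
  have h := measure_ge_le_exp_mul_mgf (μ := gaussianReal 0 1) (X := id) a ha
    (integrable_exp_mul_gaussianReal a)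
  rw [mgf_id_gaussianReal, ← Real.exp_add] at h
  have hsub : Ioi a ⊆ {ω | a ≤ id ω} := fun x hx => (mem_Ioi.1 hx).le
  refine (measureReal_mono hsub).trans (h.trans_eq ?_)
  congr 1
  simp
  ring

lemma one_le_log_exp_one_div {t : ℝ} (ht : t ∈ Ioo (0 : ℝ) 1) :
    1 ≤ Real.log (Real.exp 1 / (4 * t * (1 - t))) := by
  have h0 : 0 < 4 * t * (1 - t) := mul_pos (by linarith [ht.1]) (by linarith [ht.2])
  rw [Real.le_log_iff_exp_le (by positivity), le_div_iff₀ h0]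
  nlinarith [Real.exp_pos 1, sq_nonneg (2 * t - 1)]

lemma one_le_Gammafun {t : ℝ} (ht : t ∈ Ioo (0 : ℝ) 1) : 1 ≤ Gammafun t := by
  have := Real.log_nonneg (one_le_log_exp_one_div ht)
  simp only [Gammafun, Cfun]
  linarith

lemma Gammafun_le {t : ℝ} (ht : t ∈ Ioo (0 : ℝ) 1) :
    Gammafun t ≤ Real.log (Real.exp 1 / (4 * t * (1 - t))) := by
  have := Real.log_le_sub_one_of_pos (zero_lt_one.trans_le (one_le_log_exp_one_div ht))
  simp only [Gammafun, Cfun]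
  linarith

lemma Phi_two_mul_mem {m : ℝ} (hm : 1 ≤ m) : Phi (2 * m) ∈ Ico (1 / 2 : ℝ) 1 := by
  constructor
  · have h1 := one_sub_Phi_le (a := 2 * m) (by linarith)
    have h2 : Real.exp (-(2 * m) ^ 2 / 2) ≤ Real.exp (-1) := Real.exp_le_exp.2 (by nlinarith)
    have := Real.exp_neg_one_lt_half
    linarith
  · have h1 := density_le_one_sub_Phi (a := 2 * m) (by linarith)
    have h2 : 0 < (√(2 * Real.pi))⁻¹ * Real.exp (-(2 * m + 1) ^ 2 / 2) := by positivity
    linarith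

lemma sqrt_two_pi_le : √(2 * Real.pi) ≤ Real.exp 1 := by
  rw [Real.sqrt_le_left (by positivity)]
  nlinarith [Real.pi_lt_d2, Real.exp_one_gt_d9]

lemma Gammafun_Phi_two_mul_le {m : ℝ} (hm : 1 ≤ m) : Gammafun (Phi (2 * m)) ≤ 7 * m ^ 2 := by
  obtain ⟨h1, h2⟩ := Phi_two_mul_mem hm
  refine (Gammafun_le ⟨by linarith, h2⟩).trans ?_
  have hq := density_le_one_sub_Phi (a := 2 * m) (by linarith)
  have h0 : 0 < 1 - Phi (2 * m) := by linarith
  have h3 : Real.exp (-1) ≤ (√(2 * Real.pi))⁻¹ := by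
    rw [Real.exp_neg]
    exact inv_anti₀ (by positivity) sqrt_two_pi_le
  rw [Real.log_le_iff_le_exp (by apply div_pos (Real.exp_pos 1); apply mul_pos <;> linarith),
    div_le_iff₀ (by apply mul_pos <;> linarith)]
  have h4 : Real.exp (-(7 * m ^ 2) + 1) ≤ 1 - Phi (2 * m) := by
    refine le_trans ?_ hq
    refine le_trans ?_ (mul_le_mul_of_nonneg_right h3 (Real.exp_pos _).le)
    rw [← Real.exp_add]
    exact Real.exp_le_exp.2 (by nlinarith)
  rw [Real.exp_add, Real.exp_neg, inv_mul_le_iff₀ (Real.exp_pos _)] at h4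
  refine h4.trans (mul_le_mul_of_nonneg_left ?_ (Real.exp_pos _).le)
  nlinarith

/-- For `n ≥ 1`, the supremum defining `Deltafun` dominates each of its terms when `Fo = Phi`. -/
lemma le_Deltafun_Phi {n : ℕ} (hn : 1 ≤ n) {F : ℝ → ℝ} (hF : ∀ x, F x ∈ Icc (0 : ℝ) 1) {x : ℝ}
    (hx : Phi x ∈ Ioo (0 : ℝ) 1) :
    √n * |F x - Phi x| / (√(Gammafun (Phi x) * (Phi x * (1 - Phi x))) + Gammafun (Phi x) / √n) ≤
      Deltafun n F Phi := by
  refine le_csSup ⟨√n / (1 / √n), ?_⟩ ⟨x, hx, rfl⟩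
  rintro _ ⟨y, hy, rfl⟩
  have hn0 : (0 : ℝ) < √n := Real.sqrt_pos.2 (by exact_mod_cast hn)
  have hnum : |F y - Phi y| ≤ 1 :=
    abs_le.2 ⟨by linarith [(hF y).1, hy.2], by linarith [(hF y).2, hy.1]⟩
  have hden : 1 / √n ≤ √(Gammafun (Phi y) * (Phi y * (1 - Phi y))) + Gammafun (Phi y) / √n :=
    (div_le_div_of_nonneg_right (one_le_Gammafun hy) hn0.le).trans
      (le_add_of_nonneg_left (Real.sqrt_nonneg _))
  exact div_le_div₀ hn0.le (mul_le_of_le_one_right hn0.le hnum) (by positivity) hden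

lemma mixture_mem_Icc {e : ℝ} (he : e ∈ Ioo (0 : ℝ) 1) (m x : ℝ) :
    (1 - e) * Phi x + e * Phi (x - m) ∈ Icc (0 : ℝ) 1 :=
  convex_Icc (0 : ℝ) 1 ⟨Phi_nonneg x, Phi_le_one x⟩ ⟨Phi_nonneg (x - m), Phi_le_one (x - m)⟩
    (by linarith [he.2]) he.1.le (by ring)

lemma Deltafun_mixture_ge {n : ℕ} (hn : 1 ≤ n) {e s m : ℝ} (he : e ∈ Ioo (0 : ℝ) 1)
    (hm : 1 ≤ m) (hπ : √n * e = Real.exp (-m ^ 2 / (2 * s))) (hlog : 4 * m ^ 2 ≤ Real.log n) :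
    Real.exp ((1 - 1 / s) / 2 * m ^ 2 - m - 3 / 2) / (14 * m ^ 2) ≤
      Deltafun n (fun x => (1 - e) * Phi x + e * Phi (x - m)) Phi := by
  obtain ⟨h1, h2⟩ := Phi_two_mul_mem hm
  have ht : Phi (2 * m) ∈ Ioo (0 : ℝ) 1 := ⟨by linarith, h2⟩
  refine le_trans ?_ (le_Deltafun_Phi hn (mixture_mem_Icc he m) ht)
  have hnR : (0 : ℝ) < n := by exact_mod_cast hn
  have hn0 : (0 : ℝ) < √n := Real.sqrt_pos.2 hnR
  have hΓ := Gammafun_Phi_two_mul_le hm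
  have hΓ1 := one_le_Gammafun ht
  have hnum : Real.exp (-m ^ 2 / (2 * s) + (-1 + -(m + 1) ^ 2 / 2)) ≤
      √n * |(1 - e) * Phi (2 * m) + e * Phi (2 * m - m) - Phi (2 * m)| := by
    have h3 : (gaussianReal 0 1).real (Ioc m (m + 1)) ≤ Phi (2 * m) - Phi m := by
      rw [Phi_sub_Phi (by linarith)]
      exact measureReal_mono (Ioc_subset_Ioc_right (by linarith))
    have h4 : Real.exp (-1) ≤ (√(2 * Real.pi))⁻¹ := by
      rw [Real.exp_neg]
      exact inv_anti₀ (by positivity) sqrt_two_pi_le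
    have h5 : Real.exp (-1 + -(m + 1) ^ 2 / 2) ≤ Phi (2 * m) - Phi m := by
      rw [Real.exp_add]
      exact (mul_le_mul_of_nonneg_right h4 (Real.exp_pos _).le).trans
        ((density_le_gaussianReal_Ioc (by linarith)).trans h3)
    have h6 : (1 - e) * Phi (2 * m) + e * Phi (2 * m - m) - Phi (2 * m) =
        -(e * (Phi (2 * m) - Phi m)) := by
      rw [show 2 * m - m = m by ring]
      ring
    rw [h6, abs_neg, abs_of_nonneg (mul_nonneg he.1.le ((Real.exp_pos _).le.trans h5)),
      ← mul_assoc, hπ, Real.exp_add]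
    exact mul_le_mul_of_nonneg_left h5 (Real.exp_pos _).le
  have hm2 : 1 ≤ m ^ 2 := one_le_pow₀ hm
  have hden1 : √(Gammafun (Phi (2 * m)) * (Phi (2 * m) * (1 - Phi (2 * m)))) ≤
      7 * m ^ 2 * Real.exp (-m ^ 2) := by
    rw [Real.sqrt_le_left (by positivity)]
    have h3 := one_sub_Phi_le (a := 2 * m) (by linarith)
    have h4 : Phi (2 * m) * (1 - Phi (2 * m)) ≤ Real.exp (-m ^ 2) ^ 2 := by
      rw [← Real.exp_nat_mul]
      refine (mul_le_of_le_one_left (by linarith) h2.le).trans (h3.trans_eq ?_)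
      congr 1
      push_cast
      ring
    rw [mul_pow]
    refine (mul_le_mul hΓ h4 (mul_nonneg ht.1.le (by linarith)) (by positivity)).trans ?_
    exact mul_le_mul_of_nonneg_right (by nlinarith) (by positivity)
  have hden2 : Gammafun (Phi (2 * m)) / √n ≤ 7 * m ^ 2 * Real.exp (-m ^ 2) := by
    have h3 : Real.exp (m ^ 2) ≤ √n := by
      refine Real.le_sqrt_of_sq_le ?_
      rw [← Real.exp_nat_mul, ← Real.le_log_iff_exp_le hnR]
      push_cast
      linarith
    rw [Real.exp_neg, ← div_eq_mul_inv]
    exact div_le_div₀ (by positivity) hΓ (Real.exp_pos _) h3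
  have hden0 : 0 < √(Gammafun (Phi (2 * m)) * (Phi (2 * m) * (1 - Phi (2 * m)))) +
      Gammafun (Phi (2 * m)) / √n :=
    add_pos_of_nonneg_of_pos (Real.sqrt_nonneg _) (div_pos (by linarith) hn0)
  refine le_trans (le_of_eq ?_) (div_le_div₀ (by positivity) hnum hden0 (add_le_add hden1 hden2))
  have h7 : Real.exp (-m ^ 2 / (2 * s) + (-1 + -(m + 1) ^ 2 / 2)) =
      Real.exp ((1 - 1 / s) / 2 * m ^ 2 - m - 3 / 2) * Real.exp (-m ^ 2) := by
    rw [← Real.exp_add]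
    congr 1
    ring
  rw [h7, show 7 * m ^ 2 * Real.exp (-m ^ 2) + 7 * m ^ 2 * Real.exp (-m ^ 2) =
    14 * m ^ 2 * Real.exp (-m ^ 2) by ring, mul_div_mul_right _ _ (Real.exp_pos _).ne']

lemma tendsto_exp_quadratic_div_sq {d : ℝ} (hd : 0 < d) :
    Tendsto (fun m : ℝ => Real.exp (d * m ^ 2 - m - 3 / 2) / (14 * m ^ 2)) atTop atTop := by
  have h := (Real.tendsto_exp_div_pow_atTop 2).atTop_div_const (r := 14) (by norm_num)
  refine tendsto_atTop_mono' atTop ?_ h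
  filter_upwards [eventually_ge_atTop 1, eventually_ge_atTop (4 / d)] with m hm hmd
  rw [div_le_iff₀ hd] at hmd
  rw [div_div, mul_comm (m ^ 2)]
  gcongr
  nlinarith

/-- Lemma 4.2(b) of Dümbgen–Wellner: let `ε_n ∈ (0,1)` with `log(ε_n)/log(n) → −1/2` and
`π_n = √n ε_n → 0`.  Fix `s > 1`, set `μ_n = √(2 s log(1/π_n))` and
`F_n = (1−ε_n) Φ + ε_n Φ(· − μ_n)`.  Then `Δ_n(F_n, Φ) → ∞`. -/
theorem stmt10 (ε : ℕ → ℝ) (hε : ∀ n, ε n ∈ Set.Ioo (0:ℝ) 1)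
    (hεlim : Filter.Tendsto (fun n : ℕ => Real.log (ε n) / Real.log n)
      Filter.atTop (nhds (-(1/2 : ℝ))))
    (hπ : Filter.Tendsto (fun n : ℕ => Real.sqrt n * ε n) Filter.atTop (nhds 0))
    (s : ℝ) (hs : 1 < s) :
    Filter.Tendsto (fun n : ℕ => Deltafun n
        (fun x => (1 - ε n) * Phi x
          + ε n * Phi (x - Real.sqrt (2 * s * Real.log (1 / (Real.sqrt n * ε n))))) Phi)
      Filter.atTop Filter.atTop := by
  have hπpos : ∀ n : ℕ, 1 ≤ n → 0 < √(n : ℝ) * ε n := fun n hn =>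
    mul_pos (Real.sqrt_pos.2 (by exact_mod_cast hn)) (hε n).1
  have hL : Tendsto (fun n : ℕ => Real.log (1 / (√(n : ℝ) * ε n))) atTop atTop := by
    simp only [one_div]
    refine Real.tendsto_log_atTop.comp (Tendsto.inv_tendsto_nhdsGT_zero ?_)
    exact tendsto_nhdsWithin_iff.2 ⟨hπ, (eventually_ge_atTop 1).mono hπpos⟩
  have hμ : Tendsto (fun n : ℕ => √(2 * s * Real.log (1 / (√(n : ℝ) * ε n)))) atTop atTop :=
    Real.tendsto_sqrt_atTop.comp (hL.const_mul_atTop (by linarith))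
  have hd : 0 < (1 - 1 / s) / 2 := by
    have : 1 / s < 1 := (div_lt_one (by linarith)).2 hs
    linarith
  refine tendsto_atTop_mono' atTop ?_ ((tendsto_exp_quadratic_div_sq hd).comp hμ)
  have hratio : ∀ᶠ n : ℕ in atTop, -(1 / 2) - 1 / (8 * s) < Real.log (ε n) / Real.log n := by
    refine hεlim.eventually_const_lt ?_
    have : 0 < 1 / (8 * s) := by positivity
    linarith
  filter_upwards [hratio, hμ.eventually_ge_atTop 1, hL.eventually_ge_atTop 0,
    eventually_ge_atTop 2] with n hr hm hLn hn
  have hn1 : 1 ≤ n := by omega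
  have hlogn : 0 < Real.log n := Real.log_pos (by exact_mod_cast hn)
  have hnR : (0 : ℝ) < n := by exact_mod_cast hn1
  have hsq : √(2 * s * Real.log (1 / (√(n : ℝ) * ε n))) ^ 2 =
      2 * s * Real.log (1 / (√(n : ℝ) * ε n)) :=
    Real.sq_sqrt (mul_nonneg (by linarith) hLn)
  refine Deltafun_mixture_ge hn1 (hε n) hm ?_ ?_
  · rw [hsq, neg_div, mul_div_cancel_left₀ _ (by positivity : 2 * s ≠ 0), one_div, Real.log_inv,
      neg_neg, Real.exp_log (hπpos n hn1)]
  · have hlog : Real.log (1 / (√(n : ℝ) * ε n)) = -(Real.log n / 2 + Real.log (ε n)) := by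
      rw [one_div, Real.log_inv, Real.log_mul (Real.sqrt_pos.2 hnR).ne' (hε n).1.ne',
        Real.log_sqrt hnR.le]
    rw [lt_div_iff₀ hlogn] at hr
    rw [hsq, hlog]
    have h8 : 8 * s * ((-(1 / 2) - 1 / (8 * s)) * Real.log n) =
        -(4 * s * Real.log n) - Real.log n := by
      field_simp
      ring
    have h9 := mul_lt_mul_of_pos_left hr (show 0 < 8 * s by linarith)
    linarith
end

section
/- Let γ > 0, s ∈ [0,1] and t ∈ (0,1) with K(s,t) ≤ γ. Then the positive part (t−s)⁺ satisfies (t−s)⁺ ≤ √(2γ·s(1−s)) + (1−2s)⁺·γ and (t−s)⁺ ≤ √(2γ·t(1−t)) + (2t−1)⁺·γ, and the negative part (t−s)⁻ = (s−t)⁺ satisfies (t−s)⁻ ≤ √(2γ·s(1−s)) + (2s−1)⁺·γ and (t−s)⁻ ≤ √(2γ·t(1−t)) + (1−2t)⁺·γ. In particular, |s − t| ≤ min{ √(2·s(1−s)·γ), √(2·t(1−t)·γ) } + γ. -/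
open Set

/-- K(s,t) = s log(s/t) + (1−s) log((1−s)/(1−t)), with the convention 0·log 0 = 0
(so K(0,t) = −log(1−t) and K(1,t) = −log t). -/
noncomputable def Kfun (s t : ℝ) : ℝ :=
  s * Real.log (s / t) + (1 - s) * Real.log ((1 - s) / (1 - t))

theorem Kfun_one_sub (s t : ℝ) : Kfun (1 - s) (1 - t) = Kfun s t := by
  simp only [Kfun, sub_sub_cancel]
  ring

theorem Kfun_self {s : ℝ} (hs : s ∈ Ioo (0:ℝ) 1) : Kfun s s = 0 := by
  have h1 : s ≠ 0 := hs.1.ne'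
  have h2 : 1 - s ≠ 0 := (sub_pos.2 hs.2).ne'
  simp [Kfun, div_self h1, div_self h2]

theorem le_Kfun_zero {t : ℝ} (ht : t < 1) : t ≤ Kfun 0 t := by
  have h := Real.log_le_sub_one_of_pos (sub_pos.2 ht)
  simp only [Kfun, zero_mul, sub_zero, one_mul, zero_add, one_div, Real.log_inv]
  linarith

theorem hasDerivAt_Kfun {s t : ℝ} (hs : s ∈ Ioo (0:ℝ) 1) (ht : t ∈ Ioo (0:ℝ) 1) :
    HasDerivAt (Kfun s) ((t - s) / (t * (1 - t))) t := by
  obtain ⟨hs0, hs1⟩ := hs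
  obtain ⟨ht0, ht1⟩ := ht
  have ht1' : 0 < 1 - t := sub_pos.2 ht1
  have hs1' : 0 < 1 - s := sub_pos.2 hs1
  have d1 : HasDerivAt (fun x : ℝ => s / x) (-s / t ^ 2) t := by
    simpa using (hasDerivAt_const t s).fun_div (hasDerivAt_id t) ht0.ne'
  have d2 : HasDerivAt (fun x : ℝ => (1 - s) / (1 - x)) ((1 - s) / (1 - t) ^ 2) t := by
    simpa using (hasDerivAt_const t (1 - s)).fun_div ((hasDerivAt_id t).const_sub 1) ht1'.ne'
  have d := ((d1.log (div_pos hs0 ht0).ne').const_mul s).add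
    ((d2.log (div_pos hs1' ht1').ne').const_mul (1 - s))
  refine d.congr_deriv ?_
  field_simp
  ring

/-- A differentiable comparison: `g ≤ f` at `b` if this holds at `a` and `g' ≤ f'` on `[a, b]`. -/
theorem le_of_hasDerivAt_le {f g f' g' : ℝ → ℝ} {a b : ℝ} (hab : a ≤ b)
    (hf : ∀ x ∈ Icc a b, HasDerivAt f (f' x) x) (hg : ∀ x ∈ Icc a b, HasDerivAt g (g' x) x)
    (h : ∀ x ∈ Icc a b, g' x ≤ f' x) (ha : g a ≤ f a) : g b ≤ f b :=
  image_le_of_deriv_right_le_deriv_boundary (f := g) (B := f)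
    (fun x hx => (hg x hx).continuousAt.continuousWithinAt)
    (fun x hx => (hg x (Ico_subset_Icc_self hx)).hasDerivWithinAt) ha
    (fun x hx => (hf x hx).continuousAt.continuousWithinAt)
    (fun x hx => (hf x (Ico_subset_Icc_self hx)).hasDerivWithinAt)
    (fun x hx => h x (Ico_subset_Icc_self hx)) (right_mem_Icc.2 hab)

theorem half_sq_le_Kfun {s r c a : ℝ} (hs : s ∈ Ioo (0:ℝ) 1) (hr : 0 ≤ r)
    (hr2 : r ^ 2 = s * (1 - s)) (hc : 0 ≤ c) (hc' : 1 - 2 * s ≤ c) (ha : 0 ≤ a)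
    (hlt : s + (r * a + c * a ^ 2 / 2) < 1) :
    a ^ 2 / 2 ≤ Kfun s (s + (r * a + c * a ^ 2 / 2)) := by
  have hmem : ∀ x ∈ Icc 0 a, s + (r * x + c * x ^ 2 / 2) ∈ Ioo (0:ℝ) 1 := by
    rintro x ⟨hx0, hxa⟩
    refine ⟨by have := hs.1; positivity, lt_of_le_of_lt ?_ hlt⟩
    gcongr
  have hφ : ∀ x : ℝ, HasDerivAt (fun x => s + (r * x + c * x ^ 2 / 2)) (r + c * x) x := by
    intro x
    have := (((hasDerivAt_id x).const_mul r).add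
      ((((hasDerivAt_id x).pow 2).const_mul c).div_const 2)).const_add s
    refine this.congr_deriv ?_
    simp
    ring
  refine le_of_hasDerivAt_le (f := fun x => Kfun s (s + (r * x + c * x ^ 2 / 2)))
    (g := fun x => x ^ 2 / 2) (g' := fun x => x)
    (f' := fun x => (s + (r * x + c * x ^ 2 / 2) - s) / ((s + (r * x + c * x ^ 2 / 2)) *
      (1 - (s + (r * x + c * x ^ 2 / 2)))) * (r + c * x)) ha
    (fun x hx => HasDerivAt.comp (h₂ := Kfun s) x (hasDerivAt_Kfun hs (hmem x hx)) (hφ x))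
    (fun x _ => ?_)
    (fun x hx => ?_) ?_
  · refine (((hasDerivAt_id x).pow 2).div_const 2).congr_deriv ?_
    simp
  · obtain ⟨h0, h1⟩ := hmem x hx
    have hx0 := hx.1
    rw [div_mul_eq_mul_div, le_div_iff₀ (mul_pos h0 (sub_pos.2 h1))]
    set u := r * x + c * x ^ 2 / 2 with hu
    have hu0 : 0 ≤ u := by positivity
    have hden : (s + u) * (1 - (s + u)) ≤ r ^ 2 + c * u := by
      nlinarith [mul_nonneg hu0 (sub_nonneg.2 hc'), sq_nonneg u]
    calc x * ((s + u) * (1 - (s + u))) ≤ x * (r ^ 2 + c * u) := by gcongr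
      _ ≤ (s + u - s) * (r + c * x) := by
        have : 0 ≤ c * r * x ^ 2 := by positivity
        rw [hu]
        nlinarith
  · simp [Kfun_self hs]

theorem sub_le_of_Kfun_le_left {γ s t : ℝ} (hγ : 0 ≤ γ) (hs : 0 ≤ s) (hst : s < t) (ht : t < 1)
    (hK : Kfun s t ≤ γ) :
    t - s ≤ √(2 * γ * (s * (1 - s))) + max (1 - 2 * s) 0 * γ := by
  rcases hs.eq_or_lt with rfl | hs0
  · have := le_Kfun_zero ht
    simp
    linarith
  have hv : 0 < s * (1 - s) := mul_pos hs0 (by linarith)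
  rw [Real.sqrt_mul (by positivity)]
  set r := √(s * (1 - s))
  have hr0 : 0 < r := Real.sqrt_pos.2 hv
  set c := max (1 - 2 * s) 0
  have hc0 : 0 ≤ c := le_max_right _ _
  obtain ⟨a, ha, hat⟩ : ∃ a ∈ Icc 0 ((t - s) / r), r * a + c * a ^ 2 / 2 = t - s := by
    have hb : 0 ≤ (t - s) / r := div_nonneg (by linarith) hr0.le
    refine intermediate_value_Icc hb (f := fun a => r * a + c * a ^ 2 / 2) (by fun_prop)
      ⟨by simpa using hst.le, ?_⟩
    have : r * ((t - s) / r) = t - s := by field_simp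
    have : 0 ≤ c * ((t - s) / r) ^ 2 / 2 := by positivity
    linarith
  have key := half_sq_le_Kfun ⟨hs0, hst.trans ht⟩ hr0.le (Real.sq_sqrt hv.le) hc0
    (le_max_left _ _) ha.1 (by rw [hat]; linarith)
  rw [hat, add_sub_cancel] at key
  have ha2 : a ^ 2 ≤ 2 * γ := by linarith
  have : a ≤ √(2 * γ) := Real.le_sqrt_of_sq_le ha2
  have h1 : r * a ≤ √(2 * γ) * r := by rw [mul_comm]; gcongr
  have h2 : c * a ^ 2 ≤ c * (2 * γ) := by gcongr
  linarith

theorem sq_div_le_Kfun_of_le_half {s t : ℝ} (hs : 0 < s) (hst : s ≤ t) (ht : t ≤ 1 / 2) :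
    (t - s) ^ 2 / (2 * (t * (1 - t))) ≤ Kfun s t := by
  have hs' : s ∈ Ioo (0:ℝ) 1 := ⟨hs, by linarith⟩
  have hmem : ∀ x ∈ Icc s t, x ∈ Ioo (0:ℝ) 1 := fun x hx =>
    ⟨hs.trans_le hx.1, by linarith [hx.2]⟩
  refine le_of_hasDerivAt_le (f := Kfun s) (g := fun x => (x - s) ^ 2 / (2 * (x * (1 - x)))) hst
    (fun x hx => hasDerivAt_Kfun hs' (hmem x hx))
    (fun x hx => (((hasDerivAt_id x).sub_const s).pow 2).div
      (((hasDerivAt_id x).mul ((hasDerivAt_id x).const_sub 1)).const_mul 2) ?_)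
    (fun x hx => ?_) ?_
  · have h := hmem x hx
    exact (mul_pos two_pos (mul_pos h.1 (sub_pos.2 h.2))).ne'
  · obtain ⟨h0, h1⟩ := hmem x hx
    have h1' := sub_pos.2 h1
    have : 0 ≤ (x - s) ^ 2 * (1 - 2 * x) := mul_nonneg (sq_nonneg _) (by linarith [hx.2])
    simp
    rw [div_le_div_iff₀ (by positivity) (by positivity)]
    have : 0 ≤ (x - s) ^ 2 * (1 - 2 * x) * (x * (1 - x)) := by positivity
    nlinarith
  · simp [Kfun_self hs']

theorem sq_div_le_Kfun_of_half_le {s t : ℝ} (hs : 0 < s) (hst : s ≤ t) (ht : 1 / 2 ≤ t)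
    (ht1 : t < 1) : (t - s) ^ 2 / (t + s - 2 * t * s) ≤ Kfun s t := by
  have hs' : s ∈ Ioo (0:ℝ) 1 := ⟨hs, by linarith⟩
  have hmem : ∀ x ∈ Icc (max s (1 / 2)) t, x ∈ Ioo (0:ℝ) 1 := fun x hx =>
    ⟨hs.trans_le ((le_max_left _ _).trans hx.1), hx.2.trans_lt ht1⟩
  have hw : ∀ x ∈ Icc (max s (1 / 2)) t, 0 < x + s - 2 * x * s := fun x hx => by
    obtain ⟨h0, h1⟩ := hmem x hx
    nlinarith [mul_pos h0 (sub_pos.2 hs'.2), mul_pos hs (sub_pos.2 h1)]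
  refine le_of_hasDerivAt_le (f := Kfun s) (g := fun x => (x - s) ^ 2 / (x + s - 2 * x * s))
    (max_le hst ht)
    (fun x hx => hasDerivAt_Kfun hs' (hmem x hx))
    (fun x hx => (((hasDerivAt_id x).sub_const s).pow 2).div
      (((hasDerivAt_id x).add_const s).sub (((hasDerivAt_id x).const_mul 2).mul_const s))
      (hw x hx).ne')
    (fun x hx => ?_) ?_
  · obtain ⟨h0, h1⟩ := hmem x hx
    have hx1 : s ≤ x := (le_max_left _ _).trans hx.1
    have hx2 : 1 / 2 ≤ x := (le_max_right _ _).trans hx.1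
    have h1' := sub_pos.2 h1
    have hwx := hw x hx
    have hv : 0 < x * (1 - x) := by positivity
    simp
    rw [div_le_div_iff₀ (by positivity) hv]
    have hδ := sub_nonneg.2 hx1
    have h : 0 ≤ (x + s - 2 * x * s) * (2 * x - 1) + x * (1 - x) * (1 - 2 * s) := by
      have : (x + s - 2 * x * s) * (2 * x - 1) + x * (1 - x) * (1 - 2 * s)
          = x ^ 2 * (1 - s) - s * (1 - x) ^ 2 := by ring
      rw [this]
      nlinarith [mul_nonneg hs.le hδ, mul_nonneg hδ h0.le, mul_nonneg hδ h1'.le,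
        mul_nonneg (mul_nonneg hδ h0.le) hs.le, mul_nonneg hv.le (sub_nonneg.2 hx2),
        mul_nonneg hv.le hδ]
    have h' := mul_nonneg (mul_nonneg hδ hδ) h
    linear_combination h'
  · rcases le_total s (1 / 2) with h | h
    · have := sq_div_le_Kfun_of_le_half hs h le_rfl
      rw [max_eq_right h]
      convert this using 2
      ring
    · rw [max_eq_left h]
      simp [Kfun_self hs']

theorem sub_sq_le_of_Kfun_le {γ s t : ℝ} (hs : 0 ≤ s) (hst : s < t) (ht : t < 1)
    (hK : Kfun s t ≤ γ) :
    (t - s) ^ 2 ≤ γ * (2 * (t * (1 - t)) + max (2 * t - 1) 0 * (t - s)) := by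
  have ht0 : 0 < t := hs.trans_lt hst
  have hv : 0 < t * (1 - t) := mul_pos ht0 (sub_pos.2 ht)
  rcases hs.eq_or_lt with rfl | hs0
  · have h := (le_Kfun_zero ht).trans hK
    have hm : t ≤ 2 * (t * (1 - t)) + max (2 * t - 1) 0 * (t - 0) := by
      nlinarith [mul_le_mul_of_nonneg_right (le_max_left (2 * t - 1) 0) ht0.le]
    calc (t - 0) ^ 2 = t * t := by ring
      _ ≤ _ := mul_le_mul h hm ht0.le (ht0.le.trans h)
  rcases le_total t (1 / 2) with h | h
  · have := (sq_div_le_Kfun_of_le_half hs0 hst.le h).trans hK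
    rw [max_eq_right (by linarith), zero_mul, add_zero]
    exact (div_le_iff₀ (by positivity)).1 this
  · have := (sq_div_le_Kfun_of_half_le hs0 hst.le h ht).trans hK
    rw [max_eq_left (by linarith)]
    have hw : 2 * (t * (1 - t)) + (2 * t - 1) * (t - s) = t + s - 2 * t * s := by ring
    have hw0 : 0 ≤ (2 * t - 1) * (t - s) := mul_nonneg (by linarith) (by linarith)
    rw [hw]
    exact (div_le_iff₀ (by linarith)).1 this

theorem sub_le_of_Kfun_le_right {γ s t : ℝ} (hγ : 0 ≤ γ) (hs : 0 ≤ s) (hst : s < t) (ht : t < 1)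
    (hK : Kfun s t ≤ γ) :
    t - s ≤ √(2 * γ * (t * (1 - t))) + max (2 * t - 1) 0 * γ := by
  have hv : 0 ≤ 2 * γ * (t * (1 - t)) :=
    mul_nonneg (by positivity) (mul_nonneg (by linarith) (by linarith))
  have h := sub_sq_le_of_Kfun_le hs hst ht hK
  have hq := Real.sq_sqrt hv
  have hq0 := Real.sqrt_nonneg (2 * γ * (t * (1 - t)))
  have hc : 0 ≤ max (2 * t - 1) 0 * γ := mul_nonneg (le_max_right _ _) hγ
  by_contra! hlt
  nlinarith [mul_nonneg hq0 hc]

theorem posPart_sub_le_of_Kfun_le {γ s t : ℝ} (hγ : 0 ≤ γ) (hs : 0 ≤ s) (ht : t < 1)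
    (hK : Kfun s t ≤ γ) :
    max (t - s) 0 ≤ √(2 * γ * (s * (1 - s))) + max (1 - 2 * s) 0 * γ ∧
    max (t - s) 0 ≤ √(2 * γ * (t * (1 - t))) + max (2 * t - 1) 0 * γ := by
  rcases lt_or_ge s t with hst | hst
  · rw [max_eq_left (sub_nonneg.2 hst.le)]
    exact ⟨sub_le_of_Kfun_le_left hγ hs hst ht hK, sub_le_of_Kfun_le_right hγ hs hst ht hK⟩
  · rw [max_eq_right (sub_nonpos.2 hst)]
    constructor <;> positivity

/-- Property (K.5) of Dümbgen–Wellner: if `γ > 0`, `s ∈ [0,1]`, `t ∈ (0,1)` and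
`K(s,t) ≤ γ`, then `(t−s)⁺ ≤ √(2γ s(1−s)) + (1−2s)⁺ γ`,
`(t−s)⁺ ≤ √(2γ t(1−t)) + (2t−1)⁺ γ`, `(t−s)⁻ ≤ √(2γ s(1−s)) + (2s−1)⁺ γ`,
`(t−s)⁻ ≤ √(2γ t(1−t)) + (1−2t)⁺ γ`; in particular
`|s − t| ≤ min( √(2 s(1−s) γ), √(2 t(1−t) γ) ) + γ`. -/
theorem stmt15 (γ : ℝ) (hγ : 0 < γ) (s t : ℝ) (hs : s ∈ Set.Icc (0:ℝ) 1)
    (ht : t ∈ Set.Ioo (0:ℝ) 1) (hK : Kfun s t ≤ γ) :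
    max (t - s) 0 ≤ Real.sqrt (2 * γ * (s * (1 - s))) + max (1 - 2 * s) 0 * γ ∧
    max (t - s) 0 ≤ Real.sqrt (2 * γ * (t * (1 - t))) + max (2 * t - 1) 0 * γ ∧
    max (s - t) 0 ≤ Real.sqrt (2 * γ * (s * (1 - s))) + max (2 * s - 1) 0 * γ ∧
    max (s - t) 0 ≤ Real.sqrt (2 * γ * (t * (1 - t))) + max (1 - 2 * t) 0 * γ ∧
    |s - t| ≤ min (Real.sqrt (2 * (s * (1 - s)) * γ)) (Real.sqrt (2 * (t * (1 - t)) * γ))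
        + γ := by
  obtain ⟨h1, h2⟩ := posPart_sub_le_of_Kfun_le hγ.le hs.1 ht.2 hK
  obtain ⟨h3, h4⟩ := posPart_sub_le_of_Kfun_le hγ.le (sub_nonneg.2 hs.2)
    (sub_lt_self 1 ht.1) ((Kfun_one_sub s t).trans_le hK)
  have e : 1 - t - (1 - s) = s - t := by ring
  have e1 : (1 - s) * (1 - (1 - s)) = s * (1 - s) := by ring
  have e2 : (1 - t) * (1 - (1 - t)) = t * (1 - t) := by ring
  have e3 : 1 - 2 * (1 - s) = 2 * s - 1 := by ring
  have e4 : 2 * (1 - t) - 1 = 1 - 2 * t := by ring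
  rw [e, e1, e3] at h3
  rw [e, e2, e4] at h4
  refine ⟨h1, h2, h3, h4, ?_⟩
  have hle : ∀ x : ℝ, x ≤ 1 → max x 0 * γ ≤ γ := fun x hx =>
    mul_le_of_le_one_left hγ.le (max_le hx zero_le_one)
  rw [mul_right_comm 2 _ γ, mul_right_comm 2 _ γ, ← sub_le_iff_le_add]
  refine le_min ?_ ?_ <;> rw [sub_le_iff_le_add] <;> refine abs_le'.2 ⟨?_, ?_⟩
  · linarith [le_max_left (s - t) 0, hle (2 * s - 1) (by linarith [hs.2])]
  · linarith [le_max_left (t - s) 0, hle (1 - 2 * s) (by linarith [hs.1])]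
  · linarith [le_max_left (s - t) 0, hle (1 - 2 * t) (by linarith [ht.1])]
  · linarith [le_max_left (t - s) 0, hle (2 * t - 1) (by linarith [ht.2])]
end
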